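/- Let A be a polynomial vector field on ℂ^p with m(A) > 0, and for i = 1,…,p define y_i(t) := Σ_{n≥0} (t^n/n!)·coeff_0(D_A^n(z_i)) on the open disc {t ∈ ℂ : |t| < 1/m(A)}. Then each series converges absolutely on this disc, y_i(0) = 0 for all i, each y_i is complex differentiable there, and for every t in the disc, (d/dt)y_i(t) = A^i(y_1(t), y_2(t), …, y_p(t)), where A^i(w) denotes the evaluation of the polynomial A^i at the point w ∈ ℂ^p. -/

import Mathlib

open MvPolynomial

noncomputable def vfDeriv {p : ℕ} (A : Fin p → MvPolynomial (Fin p) ℂ)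
    (P : MvPolynomial (Fin p) ℂ) : MvPolynomial (Fin p) ℂ :=
  ∑ i, A i * pderiv i P

noncomputable def vfNorm {p : ℕ} (A : Fin p → MvPolynomial (Fin p) ℂ) : ℝ :=
  ⨆ i, ∑ m ∈ (A i).support, ‖(A i).coeff m‖


/-- The derivation of `ℂ[z₁, …, z_p]` given by the action of a polynomial vector field. -/
noncomputable def vfDerivation {p : ℕ} (A : Fin p → MvPolynomial (Fin p) ℂ) :
    Derivation ℂ (MvPolynomial (Fin p) ℂ) (MvPolynomial (Fin p) ℂ) :=
  ∑ i, A i • pderiv i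

lemma vfDerivation_apply {p : ℕ} (A : Fin p → MvPolynomial (Fin p) ℂ)
    (P : MvPolynomial (Fin p) ℂ) : vfDerivation A P = vfDeriv A P := by
  have h : (vfDerivation A : MvPolynomial (Fin p) ℂ → MvPolynomial (Fin p) ℂ) =
      ∑ i, ⇑(A i • pderiv i) :=
    map_sum (Derivation.coeFnAddMonoidHom (R := ℂ)) _ _
  simp [h, vfDeriv]

lemma vfDerivation_X {p : ℕ} (A : Fin p → MvPolynomial (Fin p) ℂ) (i : Fin p) :
    vfDerivation A (X i) = A i := by
  classical
  simp [vfDerivation_apply, vfDeriv, pderiv_X, Pi.single_apply]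

/-- The Taylor series at `0` of a polynomial along the flow of a derivation, as a linear map. -/
noncomputable def lieSeriesLinear {p : ℕ}
    (D : Derivation ℂ (MvPolynomial (Fin p) ℂ) (MvPolynomial (Fin p) ℂ)) :
    MvPolynomial (Fin p) ℂ →ₗ[ℂ] PowerSeries ℂ where
  toFun P := PowerSeries.mk fun n => (n.factorial : ℂ)⁻¹ * coeff 0 (D^[n] P)
  map_add' P Q := by
    ext n
    simp [iterate_map_add, mul_add]
  map_smul' c P := by
    ext n
    have h : D^[n] (c • P) = c • D^[n] P := by
      induction n with
      | zero => rfl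
      | succ n ih => simp only [Function.iterate_succ_apply', ih, Derivation.map_smul]
    simp only [PowerSeries.coeff_mk, h, coeff_smul, PowerSeries.coeff_smul, smul_eq_mul,
      RingHom.id_apply]
    ring

lemma derivative_lieSeriesLinear {p : ℕ}
    (D : Derivation ℂ (MvPolynomial (Fin p) ℂ) (MvPolynomial (Fin p) ℂ))
    (P : MvPolynomial (Fin p) ℂ) :
    PowerSeries.derivative ℂ (lieSeriesLinear D P) = lieSeriesLinear D (D P) := by
  ext n
  have h : (n.factorial : ℂ) ≠ 0 := by exact_mod_cast n.factorial_ne_zero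
  have h' : (n + 1 : ℂ) ≠ 0 := by exact_mod_cast n.succ_ne_zero
  simp only [lieSeriesLinear, LinearMap.coe_mk, AddHom.coe_mk, PowerSeries.coeff_derivative,
    PowerSeries.coeff_mk, Function.iterate_succ_apply, Nat.factorial_succ]
  push_cast
  field_simp

lemma lieSeriesLinear_mul {p : ℕ}
    (D : Derivation ℂ (MvPolynomial (Fin p) ℂ) (MvPolynomial (Fin p) ℂ))
    (P Q : MvPolynomial (Fin p) ℂ) :
    lieSeriesLinear D (P * Q) = lieSeriesLinear D P * lieSeriesLinear D Q := by
  ext n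
  induction n generalizing P Q with
  | zero => simp [lieSeriesLinear, ← constantCoeff_eq]
  | succ n ih =>
    have h' : (n + 1 : ℂ) ≠ 0 := by exact_mod_cast n.succ_ne_zero
    apply mul_right_cancel₀ h'
    rw [← PowerSeries.coeff_derivative, ← PowerSeries.coeff_derivative,
      derivative_lieSeriesLinear, Derivation.leibniz, Derivation.leibniz, map_add, map_add,
      map_add, derivative_lieSeriesLinear, derivative_lieSeriesLinear]
    simp only [smul_eq_mul, ih]

/-- The Taylor series at `0` of polynomials along the flow of a derivation, as an algebra map. -/
noncomputable def lieSeries {p : ℕ}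
    (D : Derivation ℂ (MvPolynomial (Fin p) ℂ) (MvPolynomial (Fin p) ℂ)) :
    MvPolynomial (Fin p) ℂ →ₐ[ℂ] PowerSeries ℂ :=
  AlgHom.ofLinearMap (lieSeriesLinear D)
    (by
      ext n
      cases n with
      | zero => simp [lieSeriesLinear]
      | succ n =>
        simp [lieSeriesLinear, PowerSeries.coeff_one, Function.iterate_succ_apply,
          iterate_map_zero])
    (lieSeriesLinear_mul D)

lemma coeff_lieSeries {p : ℕ}
    (D : Derivation ℂ (MvPolynomial (Fin p) ℂ) (MvPolynomial (Fin p) ℂ))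
    (P : MvPolynomial (Fin p) ℂ) (n : ℕ) :
    PowerSeries.coeff n (lieSeries D P) = (n.factorial : ℂ)⁻¹ * coeff 0 (D^[n] P) := by
  simp [lieSeries, lieSeriesLinear]

lemma derivative_lieSeries {p : ℕ}
    (D : Derivation ℂ (MvPolynomial (Fin p) ℂ) (MvPolynomial (Fin p) ℂ))
    (P : MvPolynomial (Fin p) ℂ) :
    PowerSeries.derivative ℂ (lieSeries D P) = lieSeries D (D P) :=
  derivative_lieSeriesLinear D P

namespace PowerSeries

/-- The weighted `ℓ¹` norm, with weight `r`, of the first `n` coefficients of a power series. -/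
noncomputable def partialNorm (r : ℝ) (n : ℕ) (f : PowerSeries ℂ) : ℝ :=
  ∑ k ∈ Finset.range n, ‖coeff k f‖ * r ^ k

lemma partialNorm_nonneg {r : ℝ} (hr : 0 ≤ r) (n : ℕ) (f : PowerSeries ℂ) :
    0 ≤ partialNorm r n f :=
  Finset.sum_nonneg fun _ _ => by positivity

lemma partialNorm_zero (r : ℝ) (n : ℕ) : partialNorm r n 0 = 0 := by
  simp [partialNorm]

lemma partialNorm_add_le {r : ℝ} (hr : 0 ≤ r) (n : ℕ) (f g : PowerSeries ℂ) :
    partialNorm r n (f + g) ≤ partialNorm r n f + partialNorm r n g := by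
  simp only [partialNorm, ← Finset.sum_add_distrib, ← add_mul, map_add]
  gcongr
  exact norm_add_le _ _

lemma partialNorm_smul (r : ℝ) (n : ℕ) (c : ℂ) (f : PowerSeries ℂ) :
    partialNorm r n (c • f) = ‖c‖ * partialNorm r n f := by
  simp [partialNorm, Finset.mul_sum, mul_assoc]

lemma partialNorm_one_le {r : ℝ} (n : ℕ) : partialNorm r n 1 ≤ 1 := by
  cases n with
  | zero => simp [partialNorm]
  | succ n => simp [partialNorm, Finset.sum_range_succ', coeff_one]

lemma partialNorm_mul_le {r : ℝ} (hr : 0 ≤ r) (n : ℕ) (f g : PowerSeries ℂ) :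
    partialNorm r n (f * g) ≤ partialNorm r n f * partialNorm r n g := by
  have hfiber : ∀ k ∈ Finset.range n, Finset.HasAntidiagonal.antidiagonal k =
      (Finset.range n ×ˢ Finset.range n).filter fun x => x.1 + x.2 = k := by
    intro k hk
    ext x
    simp only [Finset.HasAntidiagonal.mem_antidiagonal, Finset.mem_filter, Finset.mem_product,
      Finset.mem_range] at hk ⊢
    omega
  calc partialNorm r n (f * g)
      ≤ ∑ k ∈ Finset.range n, ∑ x ∈ Finset.HasAntidiagonal.antidiagonal k,
          (‖coeff x.1 f‖ * r ^ x.1) * (‖coeff x.2 g‖ * r ^ x.2) := by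
        refine Finset.sum_le_sum fun k _ => ?_
        rw [coeff_mul]
        refine (mul_le_mul_of_nonneg_right (norm_sum_le _ _) (by positivity)).trans_eq ?_
        rw [Finset.sum_mul]
        refine Finset.sum_congr rfl fun x hx => ?_
        rw [← Finset.HasAntidiagonal.mem_antidiagonal.1 hx, norm_mul, pow_add]
        ring
    _ = ∑ k ∈ Finset.range n, ∑ x ∈ Finset.range n ×ˢ Finset.range n with x.1 + x.2 = k,
          (‖coeff x.1 f‖ * r ^ x.1) * (‖coeff x.2 g‖ * r ^ x.2) :=
        Finset.sum_congr rfl fun k hk => by rw [hfiber k hk]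
    _ ≤ ∑ x ∈ Finset.range n ×ˢ Finset.range n,
          (‖coeff x.1 f‖ * r ^ x.1) * (‖coeff x.2 g‖ * r ^ x.2) := by
        rw [← Finset.sum_fiberwise_of_maps_to
          (t := Finset.range (n + n)) (g := fun x : ℕ × ℕ => x.1 + x.2)]
        · refine Finset.sum_le_sum_of_subset_of_nonneg
            (Finset.range_subset_range.2 (by omega)) fun _ _ _ => ?_
          exact Finset.sum_nonneg fun _ _ => by positivity
        · intro x hx
          simp only [Finset.mem_product, Finset.mem_range] at hx ⊢
          omega
    _ = partialNorm r n f * partialNorm r n g := by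
        rw [partialNorm, partialNorm, Finset.sum_mul_sum, Finset.sum_product]

lemma partialNorm_prod_pow_le_one {ι : Type*} {r : ℝ} (hr : 0 ≤ r) (n : ℕ)
    (Y : ι → PowerSeries ℂ) (hY : ∀ i, partialNorm r n (Y i) ≤ 1) (s : Finset ι) (m : ι → ℕ) :
    partialNorm r n (∏ i ∈ s, Y i ^ m i) ≤ 1 := by
  have hmul : ∀ f g : PowerSeries ℂ, partialNorm r n f ≤ 1 → partialNorm r n g ≤ 1 →
      partialNorm r n (f * g) ≤ 1 := fun f g hf hg =>
    (partialNorm_mul_le hr n f g).trans (mul_le_one₀ hf (partialNorm_nonneg hr n g) hg)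
  refine Finset.prod_induction _ (fun f => partialNorm r n f ≤ 1) hmul
    (partialNorm_one_le n) fun i _ => ?_
  induction m i with
  | zero => simpa using partialNorm_one_le n
  | succ k ih => rw [pow_succ]; exact hmul _ _ ih (hY i)

lemma partialNorm_aeval_le {σ : Type*} {r : ℝ} (hr : 0 ≤ r) (n : ℕ)
    (Y : σ → PowerSeries ℂ) (hY : ∀ i, partialNorm r n (Y i) ≤ 1) (P : MvPolynomial σ ℂ) :
    partialNorm r n (MvPolynomial.aeval Y P) ≤ ∑ m ∈ P.support, ‖P.coeff m‖ := by
  rw [MvPolynomial.aeval_def, eval₂_eq]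
  refine (Finset.le_sum_of_subadditive (partialNorm r n) (partialNorm_zero r n).le
    (partialNorm_add_le hr n) _ _).trans (Finset.sum_le_sum fun m _ => ?_)
  rw [← Algebra.smul_def, partialNorm_smul]
  exact mul_le_of_le_one_right (norm_nonneg _) (partialNorm_prod_pow_le_one hr n Y hY _ _)

lemma summable_of_partialNorm_le {r C : ℝ} (hr : 0 ≤ r) {f : PowerSeries ℂ}
    (h : ∀ n, partialNorm r n f ≤ C) : Summable fun n => ‖coeff n f‖ * r ^ n :=
  summable_of_sum_range_le (fun _ => by positivity) h

lemma summable_norm_coeff_mul_pow {r : ℝ} {f : PowerSeries ℂ}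
    (h : Summable fun n => ‖coeff n f‖ * r ^ n) {t : ℂ} (ht : ‖t‖ ≤ r) :
    Summable fun n => ‖coeff n f * t ^ n‖ := by
  refine h.of_nonneg_of_le (fun _ => norm_nonneg _) fun n => ?_
  rw [norm_mul, norm_pow]
  gcongr

/-- The sum at `t` of a complex power series. -/
noncomputable def complexSum (f : PowerSeries ℂ) (t : ℂ) : ℂ :=
  ∑' n, coeff n f * t ^ n

lemma complexSum_mul {f g : PowerSeries ℂ} {t : ℂ} (hf : Summable fun n => ‖coeff n f * t ^ n‖)
    (hg : Summable fun n => ‖coeff n g * t ^ n‖) :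
    complexSum (f * g) t = complexSum f t * complexSum g t := by
  rw [complexSum, complexSum, complexSum,
    tsum_mul_tsum_eq_tsum_sum_antidiagonal_of_summable_norm hf hg]
  refine tsum_congr fun n => ?_
  rw [coeff_mul, Finset.sum_mul]
  refine Finset.sum_congr rfl fun x hx => ?_
  rw [← Finset.HasAntidiagonal.mem_antidiagonal.1 hx, pow_add]
  ring

lemma complexSum_add {f g : PowerSeries ℂ} {t : ℂ} (hf : Summable fun n => ‖coeff n f * t ^ n‖)
    (hg : Summable fun n => ‖coeff n g * t ^ n‖) :
    complexSum (f + g) t = complexSum f t + complexSum g t := by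
  simp only [complexSum, map_add, add_mul]
  exact hf.of_norm.tsum_add hg.of_norm

lemma complexSum_algebraMap (c t : ℂ) : complexSum (algebraMap ℂ (PowerSeries ℂ) c) t = c := by
  rw [complexSum, tsum_eq_single 0 fun n hn => by simp [coeff_C, hn]]
  simp

lemma complexSum_algHom {σ : Type*} (φ : MvPolynomial σ ℂ →ₐ[ℂ] PowerSeries ℂ) {t : ℂ}
    (h : ∀ P, Summable fun n => ‖coeff n (φ P) * t ^ n‖) (P : MvPolynomial σ ℂ) :
    complexSum (φ P) t = eval (fun i => complexSum (φ (MvPolynomial.X i)) t) P := by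
  induction P using MvPolynomial.induction_on with
  | C c =>
    rw [← MvPolynomial.algebraMap_eq, AlgHom.commutes, complexSum_algebraMap,
      MvPolynomial.algebraMap_eq, eval_C]
  | add P Q hP hQ => rw [map_add, complexSum_add (h P) (h Q), hP, hQ, map_add]
  | mul_X P i hP =>
    rw [map_mul, complexSum_mul (h P) (h _), hP, map_mul, eval_X]

lemma hasDerivAt_complexSum {r : ℝ} {f : PowerSeries ℂ}
    (h : Summable fun n => ‖coeff n (derivative ℂ f)‖ * r ^ n) {t : ℂ} (ht : ‖t‖ < r) :
    HasDerivAt (complexSum f) (complexSum (derivative ℂ f) t) t := by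
  have hr : 0 < r := (norm_nonneg t).trans_lt ht
  have hu : Summable fun n : ℕ => ‖coeff n f‖ * (n * r ^ (n - 1)) := by
    rw [← summable_nat_add_iff 1]
    refine h.congr fun n => ?_
    rw [coeff_derivative, norm_mul, Nat.add_sub_cancel]
    rw [← Nat.cast_succ, Complex.norm_natCast, mul_assoc]
  have hbound : ∀ (n : ℕ) (y : ℂ), y ∈ Metric.ball (0 : ℂ) r →
      ‖coeff n f * (n * y ^ (n - 1))‖ ≤ ‖coeff n f‖ * (n * r ^ (n - 1)) := by
    intro n y hy
    rw [norm_mul, norm_mul, norm_pow, Complex.norm_natCast]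
    gcongr
    exact (mem_ball_zero_iff.1 hy).le
  have htb : t ∈ Metric.ball (0 : ℂ) r := mem_ball_zero_iff.2 ht
  have hsum : Summable fun n : ℕ => coeff n f * (n * t ^ (n - 1)) :=
    .of_norm_bounded hu fun n => hbound n t htb
  have key := hasDerivAt_tsum_of_isPreconnected (g := fun n y => coeff n f * y ^ n)
    (g' := fun n y => coeff n f * (n * y ^ (n - 1))) hu Metric.isOpen_ball
    (convex_ball (0 : ℂ) r).isPreconnected
    (fun n y _ => (hasDerivAt_pow n y).const_mul _) hbound (Metric.mem_ball_self hr)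
    (summable_of_ne_finset_zero (s := {0}) fun n hn => by simp_all) htb
  rw [hsum.tsum_eq_zero_add] at key
  refine key.congr_deriv ?_
  simp only [complexSum, coeff_derivative, Nat.cast_zero, zero_mul, mul_zero, zero_add,
    Nat.add_sub_cancel, Nat.cast_add, Nat.cast_one, mul_assoc]

end PowerSeries

lemma lieSeries_eq_aeval {p : ℕ}
    (D : Derivation ℂ (MvPolynomial (Fin p) ℂ) (MvPolynomial (Fin p) ℂ))
    (P : MvPolynomial (Fin p) ℂ) :
    lieSeries D P = aeval (fun i => lieSeries D (X i)) P :=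
  DFunLike.congr_fun (MvPolynomial.aeval_unique (lieSeries D)) P

lemma sum_norm_coeff_le_vfNorm {p : ℕ} (A : Fin p → MvPolynomial (Fin p) ℂ) (i : Fin p) :
    ∑ m ∈ (A i).support, ‖(A i).coeff m‖ ≤ vfNorm A :=
  le_ciSup (f := fun i => ∑ m ∈ (A i).support, ‖(A i).coeff m‖) (Set.finite_range _).bddAbove i

/-- Cauchy-type majorant estimate for the flow of a polynomial vector field starting at `0`. -/
lemma partialNorm_lieSeries_X_le_one {p : ℕ} (A : Fin p → MvPolynomial (Fin p) ℂ)
    (hm : 0 < vfNorm A) (n : ℕ) (i : Fin p) :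
    PowerSeries.partialNorm (1 / vfNorm A) n (lieSeries (vfDerivation A) (X i)) ≤ 1 := by
  have hr : 0 ≤ 1 / vfNorm A := by positivity
  induction n generalizing i with
  | zero => simp [PowerSeries.partialNorm]
  | succ n ih =>
    have hA : PowerSeries.partialNorm (1 / vfNorm A) n (lieSeries (vfDerivation A) (A i)) ≤
        vfNorm A := by
      rw [lieSeries_eq_aeval]
      exact (PowerSeries.partialNorm_aeval_le hr n _ ih _).trans (sum_norm_coeff_le_vfNorm A i)
    rw [← vfDerivation_X A i, ← derivative_lieSeries] at hA
    rw [PowerSeries.partialNorm, Finset.sum_range_succ', coeff_lieSeries]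
    simp only [Function.iterate_zero, id_eq, coeff_zero_X, mul_zero, norm_zero, zero_mul, add_zero]
    calc _ ≤ ∑ k ∈ Finset.range n, ‖PowerSeries.coeff k (PowerSeries.derivative ℂ
            (lieSeries (vfDerivation A) (X i)))‖ * (1 / vfNorm A) ^ k * (1 / vfNorm A) := by
          refine Finset.sum_le_sum fun k _ => ?_
          rw [pow_succ, ← mul_assoc, PowerSeries.coeff_derivative, norm_mul]
          gcongr
          refine le_mul_of_one_le_right (norm_nonneg _) ?_
          rw [← Nat.cast_succ, Complex.norm_natCast]
          exact_mod_cast Nat.succ_pos k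
      _ ≤ vfNorm A * (1 / vfNorm A) := by
          rw [← Finset.sum_mul]
          exact mul_le_mul_of_nonneg_right hA hr
      _ = 1 := mul_one_div_cancel hm.ne'

lemma summable_lieSeries {p : ℕ} (A : Fin p → MvPolynomial (Fin p) ℂ)
    (hm : 0 < vfNorm A) (P : MvPolynomial (Fin p) ℂ) :
    Summable fun n => ‖PowerSeries.coeff n (lieSeries (vfDerivation A) P)‖ *
      (1 / vfNorm A) ^ n := by
  have hr : 0 ≤ 1 / vfNorm A := by positivity
  refine PowerSeries.summable_of_partialNorm_le (C := ∑ m ∈ P.support, ‖P.coeff m‖) hr fun n => ?_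
  rw [lieSeries_eq_aeval]
  exact PowerSeries.partialNorm_aeval_le hr n _ (partialNorm_lieSeries_X_le_one A hm n) P

/-- for `m(A) > 0`, setting `y_i(t) := Σ_{n≥0}(t^n/n!)·coeff_0(D_A^n(z_i))`
on the disc `{t : |t| < 1/m(A)}`: each series converges absolutely there, `y_i(0) = 0`,
each `y_i` is complex differentiable there, and `y_i'(t) = A^i(y_1(t), …, y_p(t))`. -/
theorem stmt_13 (p : ℕ) (hp : 0 < p) (A : Fin p → MvPolynomial (Fin p) ℂ)
    (hm : 0 < vfNorm A) :
    let y : Fin p → ℂ → ℂ := fun i s =>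
      ∑' n : ℕ, (s ^ n / (Nat.factorial n : ℂ)) * coeff 0 ((vfDeriv A)^[n] (X i))
    (∀ i : Fin p, ∀ t : ℂ, ‖t‖ < 1 / vfNorm A →
      Summable fun n : ℕ =>
        ‖(t ^ n / (Nat.factorial n : ℂ)) * coeff 0 ((vfDeriv A)^[n] (X i))‖) ∧
    (∀ i : Fin p, y i 0 = 0) ∧
    (∀ i : Fin p, ∀ t : ℂ, ‖t‖ < 1 / vfNorm A →
      HasDerivAt (y i) (eval (fun j => y j t) (A i)) t) := by
  intro y
  have hD : ⇑(vfDerivation A) = vfDeriv A := funext (vfDerivation_apply A)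
  have hterm : ∀ (i : Fin p) (t : ℂ) (n : ℕ),
      (t ^ n / (Nat.factorial n : ℂ)) * coeff 0 ((vfDeriv A)^[n] (X i)) =
        PowerSeries.coeff n (lieSeries (vfDerivation A) (X i)) * t ^ n := by
    intro i t n
    rw [coeff_lieSeries, hD]
    ring
  have hy : ∀ i, y i = PowerSeries.complexSum (lieSeries (vfDerivation A) (X i)) :=
    fun i => funext fun t => tsum_congr (hterm i t)
  have hsum := summable_lieSeries A hm
  refine ⟨fun i t ht => ?_, fun i => ?_, fun i t ht => ?_⟩
  · simp only [hterm]
    exact PowerSeries.summable_norm_coeff_mul_pow (hsum _) ht.le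
  · change ∑' n : ℕ, _ = _
    rw [tsum_eq_single 0 fun n hn => by simp [hn]]
    simp
  · have hderiv := hsum (vfDerivation A (X i))
    rw [← derivative_lieSeries] at hderiv
    have h := PowerSeries.hasDerivAt_complexSum hderiv ht
    rw [derivative_lieSeries, vfDerivation_X, PowerSeries.complexSum_algHom _ fun P =>
      PowerSeries.summable_norm_coeff_mul_pow (hsum P) ht.le] at h
    simpa only [hy] using h
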